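/- High-frequency perturbations are Wasserstein-small. Let d ≥ 1 and let μ : ℝ^d → [0,∞) be a compactly supported integrable function with ∫_{ℝ^d} μ(v) dv = 1. For a positive integer N, define the probability density f_N(x,v) := μ(v)(1 + sin(2πN x₁)) on 𝕋^d × ℝ^d, identifying 𝕋^d with [0,1)^d. Then W₂(f_N(x,v) dx dv, μ(v) dx dv) ≤ 1/N. -/

import Mathlib

open MeasureTheory Filter Set
open scoped ENNReal Topology

noncomputable section

/-- The flat `d`-dimensional torus `𝕋^d = ℝ^d/ℤ^d`. -/
abbrev Torus (d : ℕ) := Fin d → AddCircle (1 : ℝ)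

/-- The phase space `𝕋^d × ℝ^d`. -/
abbrev Phase (d : ℕ) := Torus d × (Fin d → ℝ)

/-- Canonical projection `ℝ^d → 𝕋^d`. -/
def projT (d : ℕ) (x : Fin d → ℝ) : Torus d := fun i => (x i : AddCircle (1 : ℝ))

/-- The representative in `[0,1)^d` of a point of the torus. -/
def repT (d : ℕ) (y : Torus d) : Fin d → ℝ := fun i => (AddCircle.equivIco 1 0 (y i) : ℝ)

/-- Fundamental domain `[0,1)^d` of the torus. -/
def Cube (d : ℕ) : Set (Fin d → ℝ) := Set.univ.pi fun _ => Set.Ico (0 : ℝ) 1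

/-- `ℤ^d`-periodicity of a function on `ℝ^d` (i.e. the function descends to `𝕋^d`). -/
def ZPeriodic {d : ℕ} {E : Type*} (F : (Fin d → ℝ) → E) : Prop :=
  ∀ (x : Fin d → ℝ) (k : Fin d → ℤ), F (x + fun i => (k i : ℝ)) = F x

/-- The gradient, as the vector of partial derivatives. -/
def gradx {d : ℕ} (g : (Fin d → ℝ) → ℝ) (x : Fin d → ℝ) : Fin d → ℝ :=
  fun i => fderiv ℝ g x (Pi.single i 1)

/-- The Laplacian, as the sum of the second partial derivatives. -/
def lap {d : ℕ} (g : (Fin d → ℝ) → ℝ) (x : Fin d → ℝ) : ℝ :=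
  ∑ i, fderiv ℝ (fun y => fderiv ℝ g y (Pi.single i 1)) x (Pi.single i 1)

/-- The measure on the phase space `𝕋^d × ℝ^d` induced by a (periodic-in-`x`)
density `f(x,v)` on `ℝ^d × ℝ^d`. -/
def measOfDensity (d : ℕ) (f : (Fin d → ℝ) → (Fin d → ℝ) → ℝ) : Measure (Phase d) :=
  Measure.map (fun z : (Fin d → ℝ) × (Fin d → ℝ) => (projT d z.1, z.2))
    ((((volume : Measure (Fin d → ℝ)).restrict (Cube d)).prod
        (volume : Measure (Fin d → ℝ))).withDensity fun z => ENNReal.ofReal (f z.1 z.2))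

/-- Couplings of two measures on the phase space. -/
def couplings (d : ℕ) (μ ν : Measure (Phase d)) : Set (Measure (Phase d × Phase d)) :=
  {π | π.map Prod.fst = μ ∧ π.map Prod.snd = ν}

/-- The Wasserstein distance of order `p` (valued in `ℝ≥0∞`), with respect to the
standard metric on `𝕋^d × ℝ^d`. -/
def Wass (d : ℕ) (p : ℝ) (μ ν : Measure (Phase d)) : ℝ≥0∞ :=
  ⨅ π ∈ couplings d μ ν, (∫⁻ z, edist z.1 z.2 ^ p ∂π) ^ (1 / p)

/-- Periodization of a function on `ℝ^d` over the lattice `ℤ^d`. -/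
def periodize {d : ℕ} (g : (Fin d → ℝ) → ℝ) (x : Fin d → ℝ) : ℝ :=
  ∑' k : Fin d → ℤ, g (x + fun i => (k i : ℝ))

/-- The rescaled charge shape `χ_r(x) = r^{-d} χ(x/r)`. -/
def chiR (d : ℕ) (r : ℝ) (χ : (Fin d → ℝ) → ℝ) (x : Fin d → ℝ) : ℝ :=
  (1 / r ^ d) * χ fun i => x i / r

/-- Hypotheses on the shape `χ` of an extended charge: smooth, compactly supported,
nonnegative, radially symmetric, with unit mass. -/
def IsChargeShape (d : ℕ) (χ : (Fin d → ℝ) → ℝ) : Prop :=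
  ContDiff ℝ (⊤ : ℕ∞) χ ∧ HasCompactSupport χ ∧ (∀ x, 0 ≤ χ x) ∧
    (∀ x y : Fin d → ℝ, (∑ i, x i ^ 2) = (∑ i, y i ^ 2) → χ x = χ y) ∧
    ∫ x, χ x = 1

/-- Time-dependent test functions on `𝕋^d × ℝ^d`: smooth, `ℤ^d`-periodic in `x`,
compactly supported in `v`. -/
def IsTestXV (d : ℕ) (φ : ℝ → (Fin d → ℝ) → (Fin d → ℝ) → ℝ) : Prop :=
  ContDiff ℝ (⊤ : ℕ∞) (fun p : ℝ × (Fin d → ℝ) × (Fin d → ℝ) => φ p.1 p.2.1 p.2.2) ∧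
  (∀ t v, ZPeriodic fun x => φ t x v) ∧
  ∃ R : ℝ, ∀ t x v, R < ‖v‖ → φ t x v = 0

/-- Static test functions on `𝕋^d × ℝ^d`: smooth, `ℤ^d`-periodic in `x`,
compactly supported in `v`. -/
def IsTestXVStatic (d : ℕ) (ψ : (Fin d → ℝ) → (Fin d → ℝ) → ℝ) : Prop :=
  ContDiff ℝ (⊤ : ℕ∞) (fun p : (Fin d → ℝ) × (Fin d → ℝ) => ψ p.1 p.2) ∧
  (∀ v, ZPeriodic fun x => ψ x v) ∧
  ∃ R : ℝ, ∀ x v, R < ‖v‖ → ψ x v = 0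

/-- The integrand of the weak formulation of a Vlasov equation with force field `E`:
`∂_t φ + v · ∇_x φ + E · ∇_v φ`. -/
def vlasovIntegrand (d : ℕ) (E : ℝ → (Fin d → ℝ) → (Fin d → ℝ))
    (φ : ℝ → (Fin d → ℝ) → (Fin d → ℝ) → ℝ) (t : ℝ) (x v : Fin d → ℝ) : ℝ :=
  deriv (fun s => φ s x v) t + fderiv ℝ (fun y => φ t y v) x v
    + fderiv ℝ (fun w => φ t x w) v (E t x)

/-- `U` is a weak solution of the (scaled) Poisson–Boltzmann equation
`ε² ΔU = e^U − h` on the torus, with source `h`. -/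
def IsWeakPB (d : ℕ) (ε : ℝ) (U : (Fin d → ℝ) → ℝ) (h : (Fin d → ℝ) → ℝ) : Prop :=
  ∀ φ : (Fin d → ℝ) → ℝ, ContDiff ℝ (⊤ : ℕ∞) φ → ZPeriodic φ →
    ε ^ 2 * ∫ x in Cube d, U x * lap φ x = ∫ x in Cube d, (Real.exp (U x) - h x) * φ x

/-- `f` is a bounded-density weak solution of the scaled Vlasov–Poisson system with
massless electrons `(VPME)_ε` on the time interval `[0,T)`, with initial datum `f₀`
(`ε = 1` is the unscaled VPME system). -/
structure IsVPMESolOn (d : ℕ) (ε : ℝ) (f₀ : (Fin d → ℝ) → (Fin d → ℝ) → ℝ)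
    (f : ℝ → (Fin d → ℝ) → (Fin d → ℝ) → ℝ) (T : ℝ) : Prop where
  nonneg : ∀ t x v, 0 ≤ f t x v
  periodic : ∀ t v, ZPeriodic fun x => f t x v
  mass : ∀ t ∈ Icc 0 T, ∫ x in Cube d, ∫ v, f t x v = 1
  boundedDensity : ∀ T' ∈ Ico 0 T, ∃ M : ℝ, ∀ t ∈ Icc 0 T', ∀ x, (∫ v, f t x v) ≤ M
  field : ∃ U : ℝ → (Fin d → ℝ) → ℝ,
    (∀ t, ZPeriodic (U t)) ∧ (∀ t, ContDiff ℝ 1 (U t)) ∧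
    (∀ t ∈ Icc 0 T, IsWeakPB d ε (U t) fun x => ∫ v, f t x v) ∧
    (∀ φ : ℝ → (Fin d → ℝ) → (Fin d → ℝ) → ℝ, IsTestXV d φ →
      (∃ b, b < T ∧ ∀ t x v, b ≤ t → φ t x v = 0) →
      (∫ t in Ioi (0 : ℝ), ∫ x in Cube d, ∫ v,
          vlasovIntegrand d (fun t x => -gradx (U t) x) φ t x v * f t x v)
        + (∫ x in Cube d, ∫ v, φ 0 x v * f₀ x v) = 0)

/-- `g` is a measure-valued distributional solution of the kinetic isothermal Euler
system on `[0,T)`, with initial datum `g₀`. -/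
structure IsKIsESolOn (d : ℕ) (g₀ : Measure (Phase d)) (g : ℝ → Measure (Phase d))
    (T : ℝ) : Prop where
  prob : ∀ t ∈ Icc 0 T, IsProbabilityMeasure (g t)
  density : ∃ ρ : ℝ → (Fin d → ℝ) → ℝ,
    (∀ t ∈ Icc 0 T, ZPeriodic (ρ t) ∧ ContDiff ℝ 1 (ρ t) ∧ ∀ x, 0 < ρ t x) ∧
    (∀ t ∈ Icc 0 T, (g t).map Prod.fst =
      (((volume : Measure (Fin d → ℝ)).restrict (Cube d)).withDensity
          fun x => ENNReal.ofReal (ρ t x)).map (projT d)) ∧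
    (∀ φ : ℝ → (Fin d → ℝ) → (Fin d → ℝ) → ℝ, IsTestXV d φ →
      (∃ b, b < T ∧ ∀ t x v, b ≤ t → φ t x v = 0) →
      (∫ t in Ioi (0 : ℝ), ∫ z, vlasovIntegrand d
          (fun t x => -gradx (fun y => Real.log (ρ t y)) x) φ t (repT d z.1) z.2 ∂(g t))
        + (∫ z, φ 0 (repT d z.1) z.2 ∂g₀) = 0)

/-- The extended-ion dynamics: `N` extended charges of shape `χ_r` interacting through
the (scaled) Poisson–Boltzmann coupling with parameter `ε` (`ε = 1` is unscaled). -/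
def IsExtIonSol (d N : ℕ) (ε r : ℝ) (χ : (Fin d → ℝ) → ℝ)
    (X V : ℝ → Fin N → (Fin d → ℝ)) : Prop :=
  ∃ U : ℝ → (Fin d → ℝ) → ℝ,
    (∀ t, ZPeriodic (U t)) ∧ (∀ t, ContDiff ℝ 1 (U t)) ∧
    (∀ t, IsWeakPB d ε (U t)
      fun x => (N : ℝ)⁻¹ * ∑ j, periodize (chiR d r χ) (x - X t j)) ∧
    (∀ t, ∀ i,
      HasDerivAt (fun s => X s i) (V t i) t ∧
      HasDerivAt (fun s => V s i) (-∫ y, chiR d r χ y • gradx (U t) (X t i - y)) t)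

/-- Empirical measure of the `N`-particle configuration at time `t`, as a measure on
the phase space `𝕋^d × ℝ^d`. -/
def empMeas (d N : ℕ) (X V : ℝ → Fin N → (Fin d → ℝ)) (t : ℝ) : Measure (Phase d) :=
  (N : ℝ≥0∞)⁻¹ • ∑ i, Measure.dirac (projT d (X t i), V t i)

/-- The analytic norm `‖h‖_{B_δ} = Σ_k |ĥ(k)| δ^{|k|}` (valued in `ℝ≥0∞`). -/
def Bnorm (d : ℕ) (δ : ℝ) (h : (Fin d → ℝ) → ℝ) : ℝ≥0∞ :=
  ∑' k : Fin d → ℤ,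
    (‖∫ x in Cube d, Complex.exp (-2 * Real.pi * Complex.I * ∑ i, (k i : ℂ) * (x i : ℂ))
        * (h x : ℂ)‖₊ : ℝ≥0∞) * ENNReal.ofReal (δ ^ ∑ i, (k i).natAbs)

/-- The energy of the scaled VPME system:
`½∫|v|²f + (ε²/2)∫|∇U|² + ∫U e^U`. -/
def vpmeEnergy (d : ℕ) (ε : ℝ) (f : (Fin d → ℝ) → (Fin d → ℝ) → ℝ)
    (U : (Fin d → ℝ) → ℝ) : ℝ :=
  (1 / 2) * (∫ x in Cube d, ∫ v, (∑ i, v i ^ 2) * f x v)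
    + (ε ^ 2 / 2) * (∫ x in Cube d, ∑ i, fderiv ℝ U x (Pi.single i 1) ^ 2)
    + ∫ x in Cube d, U x * Real.exp (U x)

/-- If `T` transports the density `g` on the `i`-th factor to the factor measure itself, then
applying `T` to the `i`-th coordinate does the same on the product. -/
theorem map_update_withDensity_pi {ι : Type*} [Fintype ι] [DecidableEq ι] {X : ι → Type*}
    [∀ j, MeasurableSpace (X j)] (ν : ∀ j, Measure (X j)) [∀ j, SigmaFinite (ν j)]
    (i : ι) {T : X i → X i} (hT : Measurable T) {g : X i → ℝ≥0∞} (hg : Measurable g)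
    (h : ((ν i).withDensity g).map T = ν i) :
    ((Measure.pi ν).withDensity fun x => g (x i)).map
      (fun x => Function.update x i (T (x i))) = Measure.pi ν := by
  refine (Measure.pi_eq fun s hs => ?_).symm
  have hm : Measurable fun x : ∀ j, X j => Function.update x i (T (x i)) :=
    measurable_update'.comp (measurable_id.prodMk (hT.comp (measurable_pi_apply i)))
  have hpre : (fun x : ∀ j, X j => Function.update x i (T (x i))) ⁻¹' univ.pi s
      = univ.pi (Function.update s i (T ⁻¹' s i)) := by
    ext x
    simp only [mem_preimage, mem_univ_pi]
    refine forall_congr' fun j => ?_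
    by_cases hj : j = i
    · subst hj
      simp
    · simp [Function.update_of_ne hj]
  have hmeas : ∀ j, MeasurableSet (Function.update s i (T ⁻¹' s i) j) := fun j => by
    by_cases hj : j = i
    · subst hj
      simpa using hT (hs j)
    · simpa [Function.update_of_ne hj] using hs j
  have hfactor : ∫⁻ x in T ⁻¹' s i, g x ∂ν i = ν i (s i) := by
    rw [← withDensity_apply _ (hT (hs i)), ← Measure.map_apply hT (hs i), h]
  have hprod : ∏ j ∈ Finset.univ.erase i,
      (ν j).restrict (Function.update s i (T ⁻¹' s i) j) univ
      = ∏ j ∈ Finset.univ.erase i, ν j (s j) :=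
    Finset.prod_congr rfl fun j hj => by
      rw [Function.update_of_ne (Finset.ne_of_mem_erase hj), Measure.restrict_apply_univ]
  rw [Measure.map_apply hm (.univ_pi hs), hpre, withDensity_apply _ (.univ_pi hmeas),
    Measure.restrict_pi_pi, ← lintegral_map (f := g) hg (measurable_pi_apply i),
    Measure.pi_map_eval, lintegral_smul_measure, hprod, Function.update_self, hfactor,
    smul_eq_mul, mul_comm, Finset.mul_prod_erase _ (fun j => ν j (s j)) (Finset.mem_univ i)]

/-- The antiderivative of `1 + sin (2πN ·)` vanishing at `0`. -/
def sinTransport (N : ℕ) (x : ℝ) : ℝ :=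
  x + (1 - Real.cos (2 * Real.pi * N * x)) / (2 * Real.pi * N)

theorem hasDerivAt_sinTransport {N : ℕ} (hN : 0 < N) (x : ℝ) :
    HasDerivAt (sinTransport N) (1 + Real.sin (2 * Real.pi * N * x)) x := by
  have hc : 2 * Real.pi * (N : ℝ) ≠ 0 := by positivity
  have h := (hasDerivAt_id x).add
    ((((hasDerivAt_id x).const_mul (2 * Real.pi * (N : ℝ))).cos.const_sub 1).div_const
      (2 * Real.pi * (N : ℝ)))
  convert! h using 1
  simp only [id, mul_one]
  field_simp

theorem continuous_sinTransport (N : ℕ) : Continuous (sinTransport N) := by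
  unfold sinTransport
  fun_prop

theorem monotone_sinTransport {N : ℕ} (hN : 0 < N) : Monotone (sinTransport N) := by
  refine monotone_of_deriv_nonneg
    (fun x => (hasDerivAt_sinTransport hN x).differentiableAt) fun x => ?_
  rw [(hasDerivAt_sinTransport hN x).deriv]
  linarith [Real.neg_one_le_sin (2 * Real.pi * N * x)]

theorem sinTransport_image_Icc {N : ℕ} (hN : 0 < N) :
    sinTransport N '' Icc 0 1 = Icc 0 1 := by
  have h0 : sinTransport N 0 = 0 := by simp [sinTransport]
  have h1 : sinTransport N 1 = 1 := by
    have := Real.cos_nat_mul_two_pi N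
    simp [sinTransport, mul_comm (2 * Real.pi) (N : ℝ), this]
  refine Subset.antisymm ?_ ?_
  · rintro _ ⟨x, hx, rfl⟩
    exact ⟨h0 ▸ monotone_sinTransport hN hx.1, (monotone_sinTransport hN hx.2).trans_eq h1⟩
  · have := intermediate_value_Icc zero_le_one (continuous_sinTransport N).continuousOn
    rwa [h0, h1] at this

theorem abs_sinTransport_sub_le {N : ℕ} (hN : 0 < N) (x : ℝ) :
    |sinTransport N x - x| ≤ 1 / N := by
  have hN' : (0 : ℝ) < N := by exact_mod_cast hN
  have hc : 0 < 2 * Real.pi * (N : ℝ) := by positivity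
  rw [sinTransport, add_sub_cancel_left, abs_div, abs_of_pos hc, div_le_div_iff₀ hc hN',
    abs_of_nonneg (by linarith [Real.cos_le_one (2 * Real.pi * N * x)])]
  have h := Real.neg_one_le_cos (2 * Real.pi * N * x)
  have := Real.pi_gt_three
  nlinarith

/-- `sinTransport N` pushes `(1 + sin (2πN x)) dx` on `[0,1)` to Lebesgue measure. -/
theorem map_sinTransport {N : ℕ} (hN : 0 < N) :
    (((volume : Measure ℝ).restrict (Ico 0 1)).withDensity
      fun x => ENNReal.ofReal (1 + Real.sin (2 * Real.pi * N * x))).map (sinTransport N)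
      = (volume : Measure ℝ).restrict (Ico 0 1) := by
  rw [restrict_Ico_eq_restrict_Icc]
  have hT := (continuous_sinTransport N).measurable
  refine Measure.ext_of_lintegral _ fun u hu => ?_
  rw [lintegral_map hu hT, lintegral_withDensity_eq_lintegral_mul (g := fun x => u (sinTransport N x)) _
    (by fun_prop) (hu.comp hT)]
  have h := lintegral_image_eq_lintegral_deriv_mul_of_monotoneOn (s := Icc (0 : ℝ) 1)
    measurableSet_Icc (fun x _ => (hasDerivAt_sinTransport hN x).hasDerivWithinAt)
    ((monotone_sinTransport hN).monotoneOn _) u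
  rw [sinTransport_image_Icc hN] at h
  rw [h]
  rfl

theorem measurable_projT (d : ℕ) : Measurable (projT d) :=
  measurable_pi_iff.2 fun i => AddCircle.measurable_mk'.comp (measurable_pi_apply i)

theorem edist_projT_update_le (d : ℕ) (x : Fin d → ℝ) (i : Fin d) (y : ℝ) :
    edist (projT d x) (projT d (Function.update x i y)) ≤ ENNReal.ofReal |y - x i| := by
  refine edist_pi_le_iff.2 fun j => ?_
  by_cases hj : j = i
  · subst hj
    rw [projT, projT, Function.update_self, edist_dist, dist_eq_norm, ← AddCircle.coe_sub]
    refine ENNReal.ofReal_le_ofReal ?_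
    rw [← Real.norm_eq_abs, norm_sub_rev y]
    exact QuotientAddGroup.norm_mk_le_norm
  · simp [projT, Function.update_of_ne hj]

/-- A pair of maps from a probability space with displacement at most `C` bounds the
Wasserstein distance of the two images by `C`. -/
theorem Wass_le_of_map {Z : Type*} [MeasurableSpace Z] {d : ℕ} {p : ℝ} (hp : 0 < p)
    {m : Measure Z} (hm : m univ = 1) {F G : Z → Phase d} (hF : Measurable F)
    (hG : Measurable G) {C : ℝ≥0∞} (h : ∀ z, edist (F z) (G z) ≤ C) :
    Wass d p (m.map F) (m.map G) ≤ C := by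
  have hπ : m.map (fun z => (F z, G z)) ∈ couplings d (m.map F) (m.map G) :=
    ⟨Measure.map_map measurable_fst (hF.prodMk hG), Measure.map_map measurable_snd (hF.prodMk hG)⟩
  refine (iInf₂_le _ hπ).trans ?_
  calc (∫⁻ z, edist z.1 z.2 ^ p ∂m.map fun z => (F z, G z)) ^ (1 / p)
      ≤ (∫⁻ _, C ^ p ∂m) ^ (1 / p) := by
        refine ENNReal.rpow_le_rpow ((lintegral_map_le _ _).trans (lintegral_mono fun z => ?_))
          (by positivity)
        exact ENNReal.rpow_le_rpow (h z) hp.le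
    _ = C := by
        rw [lintegral_const, hm, mul_one, ← ENNReal.rpow_mul, mul_one_div_cancel hp.ne',
          ENNReal.rpow_one]

theorem restrict_Cube (d : ℕ) : (volume : Measure (Fin d → ℝ)).restrict (Cube d)
    = Measure.pi fun _ => (volume : Measure ℝ).restrict (Ico 0 1) := by
  rw [Cube, volume_pi, Measure.restrict_pi_pi]

theorem measOfDensity_mul {d : ℕ} {a b : (Fin d → ℝ) → ℝ} (ha : Measurable a)
    (hb : AEMeasurable b) (hb0 : ∀ v, 0 ≤ b v) :
    measOfDensity d (fun x v => b v * a x)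
      = ((((volume : Measure (Fin d → ℝ)).restrict (Cube d)).withDensity
          fun x => ENNReal.ofReal (a x)).prod
            (volume.withDensity fun v => ENNReal.ofReal (b v))).map (Prod.map (projT d) id) := by
  rw [prod_withDensity₀ ha.ennreal_ofReal.aemeasurable hb.ennreal_ofReal, measOfDensity]
  simp_rw [ENNReal.ofReal_mul (hb0 _), mul_comm]
  rfl

/-- **High-frequency perturbations are Wasserstein-small.**
The density `f_N(x,v) = μ(v)(1 + sin(2πN x₁))` is `W₂`-close to the spatially
homogeneous profile `μ(v)` at rate `1/N`. -/
theorem high_frequency_perturbation_Wasserstein_small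
    (d : ℕ) (hd : 1 ≤ d) (μ : (Fin d → ℝ) → ℝ)
    (hμint : MeasureTheory.Integrable μ) (hμsupp : HasCompactSupport μ)
    (hμnn : ∀ v, 0 ≤ μ v) (hμmass : ∫ v, μ v = 1)
    (N : ℕ) (hN : 0 < N) :
    Wass d 2
      (measOfDensity d fun x v =>
        μ v * (1 + Real.sin (2 * Real.pi * (N : ℝ) * x ⟨0, hd⟩)))
      (measOfDensity d fun _ v => μ v)
    ≤ ENNReal.ofReal (1 / (N : ℝ)) := by
  set i : Fin d := ⟨0, hd⟩
  set S : (Fin d → ℝ) → Fin d → ℝ := fun x => Function.update x i (sinTransport N (x i))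
  have hS : Measurable S :=
    measurable_update'.comp (measurable_id.prodMk
      ((continuous_sinTransport N).measurable.comp (measurable_pi_apply i)))
  set g : ℝ → ℝ≥0∞ := fun t => ENNReal.ofReal (1 + Real.sin (2 * Real.pi * N * t))
  set m₁ := ((volume : Measure (Fin d → ℝ)).restrict (Cube d)).withDensity fun x => g (x i)
  set m₂ := (volume : Measure (Fin d → ℝ)).withDensity fun v => ENNReal.ofReal (μ v)
  have hm₁ : m₁.map S = (volume : Measure (Fin d → ℝ)).restrict (Cube d) := by
    simp only [m₁, restrict_Cube]
    exact map_update_withDensity_pi (fun _ => (volume : Measure ℝ).restrict (Ico 0 1)) i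
      (continuous_sinTransport N).measurable (by fun_prop) (map_sinTransport hN)
  have hm₂ : m₂ univ = 1 := by
    rw [withDensity_apply _ MeasurableSet.univ, setLIntegral_univ,
      ← ofReal_integral_eq_lintegral_ofReal hμint (.of_forall hμnn), hμmass, ENNReal.ofReal_one]
  have hcube : (volume : Measure (Fin d → ℝ)).restrict (Cube d) univ = 1 := by
    simp [restrict_Cube, Measure.pi_univ]
  have hm : (m₁.prod m₂) univ = 1 := by
    rw [← univ_prod_univ, Measure.prod_prod, hm₂, mul_one, ← preimage_univ (f := S),
      ← Measure.map_apply hS .univ, hm₁, hcube]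
  have hP : Measurable (projT d) := measurable_projT d
  have hsource : measOfDensity d (fun x v =>
      μ v * (1 + Real.sin (2 * Real.pi * (N : ℝ) * x i)))
      = (m₁.prod m₂).map (Prod.map (projT d) id) :=
    measOfDensity_mul (a := fun x => 1 + Real.sin (2 * Real.pi * (N : ℝ) * x i))
      (by fun_prop) hμint.aemeasurable hμnn
  have htarget : measOfDensity d (fun _ v => μ v)
      = (m₁.prod m₂).map (Prod.map (projT d ∘ S) id) := by
    have h := measOfDensity_mul (d := d) (a := fun _ => 1) measurable_const
      hμint.aemeasurable hμnn
    simp only [mul_one, ENNReal.ofReal_one] at h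
    rw [h, ← Pi.one_def, withDensity_one, ← hm₁]
    change ((m₁.map S).prod m₂).map _ = _
    nth_rewrite 1 [← Measure.map_id (μ := m₂)]
    rw [Measure.map_prod_map _ _ hS measurable_id,
      Measure.map_map (hP.prodMap measurable_id) (hS.prodMap measurable_id)]
    rfl
  rw [hsource, htarget]
  refine Wass_le_of_map two_pos hm (hP.prodMap measurable_id)
    ((hP.comp hS).prodMap measurable_id) fun z => ?_
  rw [Prod.edist_eq]
  refine max_le ((edist_projT_update_le d z.1 i _).trans
    (ENNReal.ofReal_le_ofReal (abs_sinTransport_sub_le hN _))) (by simp)
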